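/- arXiv:2512.16286 — 2 statements merged into one kernel-verified Lean document; each statement's English description precedes it below -/
import Mathlib

section
/- Pressure-work identity for one phase (identity (3.3) in the paper). Let d ≥ 1 and γ > 1. Let α, ρ : ℝ × ℝ^d → ℝ and u : ℝ × ℝ^d → ℝ^d be smooth ℤ^d-periodic functions with ρ > 0, satisfying the mass equation ∂ₜ(αρ) + div(αρu) = 0. Then for every time t: ∫_{[0,1]^d} α ∇(ρ^γ)·u dx = d/dt ∫_{[0,1]^d} αρ^γ/(γ−1) dx + ∫_{[0,1]^d} ρ^γ ∂ₜα dx. -/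
open MeasureTheory Real

noncomputable section

/-- A space–time point: time in `ℝ`, space in `ℝ^d`. -/
abbrev Pt (d : ℕ) := ℝ × (Fin d → ℝ)

/-- Time derivative `∂ₜ f`. -/
def pt {d : ℕ} (f : Pt d → ℝ) (p : Pt d) : ℝ :=
  fderiv ℝ f p (1, 0)

/-- Spatial partial derivative `∂_{x i} f`. -/
def pd {d : ℕ} (i : Fin d) (f : Pt d → ℝ) (p : Pt d) : ℝ :=
  fderiv ℝ f p (0, Pi.single i 1)

/-- Spatial divergence of a vector field. -/
def divg {d : ℕ} (u : Pt d → Fin d → ℝ) (p : Pt d) : ℝ :=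
  ∑ i, pd i (fun q => u q i) p

/-- Spatial Laplacian of a scalar function. -/
def lap {d : ℕ} (f : Pt d → ℝ) (p : Pt d) : ℝ :=
  ∑ i, pd i (fun q => pd i f q) p

/-- `i`-th component of `div (r u ⊗ u)`, i.e. `∑ j ∂_{x j} (r u_i u_j)`. -/
def divT {d : ℕ} (r : Pt d → ℝ) (u : Pt d → Fin d → ℝ) (p : Pt d) (i : Fin d) : ℝ :=
  ∑ j, pd j (fun q => r q * u q i * u q j) p

/-- Symmetric gradient `D(u) = (∇u + (∇u)ᵀ)/2`. -/
def Dsym {d : ℕ} (u : Pt d → Fin d → ℝ) (p : Pt d) (i j : Fin d) : ℝ :=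
  (pd j (fun q => u q i) p + pd i (fun q => u q j) p) / 2

/-- Divergence of a matrix field, `i`-th component `∑ j ∂_{x j} M_{ij}`. -/
def divM {d : ℕ} (M : Pt d → Fin d → Fin d → ℝ) (p : Pt d) (i : Fin d) : ℝ :=
  ∑ j, pd j (fun q => M q i j) p

/-- `ℤ^d`-periodicity in the space variable. -/
def ZPeriodic {d : ℕ} (f : Pt d → ℝ) : Prop :=
  ∀ (k : Fin d → ℤ) (t : ℝ) (x : Fin d → ℝ), f (t, x + fun i => (k i : ℝ)) = f (t, x)

/-- `ℤ^d`-periodicity of a vector field. -/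
def ZPeriodicVec {d : ℕ} (u : Pt d → Fin d → ℝ) : Prop :=
  ∀ i, ZPeriodic (fun q => u q i)

/-- The unit cell `[0,1]^d`. -/
def cell (d : ℕ) : Set (Fin d → ℝ) := Set.Icc 0 1

theorem continuous_pt {d : ℕ} {f : Pt d → ℝ} (hf : ContDiff ℝ 1 f) : Continuous (pt f) :=
  (hf.continuous_fderiv one_ne_zero).clm_apply continuous_const

theorem continuous_pd {d : ℕ} (i : Fin d) {f : Pt d → ℝ} (hf : ContDiff ℝ 1 f) :
    Continuous (pd i f) :=
  (hf.continuous_fderiv one_ne_zero).clm_apply continuous_const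

theorem isCompact_cell (d : ℕ) : IsCompact (cell d) := isCompact_Icc

theorem Continuous.integrableOn_cell {d : ℕ} {f : Pt d → ℝ} (hf : Continuous f) (t : ℝ) :
    IntegrableOn (fun x => f (t, x)) (cell d) :=
  (by fun_prop : Continuous fun x => f (t, x)).continuousOn.integrableOn_compact (isCompact_cell d)

/-- Differentiation under the integral over the unit cell. -/
theorem hasDerivAt_integral_cell {d : ℕ} {f : Pt d → ℝ} (hf : ContDiff ℝ 1 f) (t : ℝ) :
    HasDerivAt (fun s => ∫ x in cell d, f (s, x)) (∫ x in cell d, pt f (t, x)) t := by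
  obtain ⟨C, hC⟩ := ((isCompact_Icc (a := t - 1) (b := t + 1)).prod
    (isCompact_cell d)).exists_bound_of_continuousOn (continuous_pt hf).continuousOn
  refine (hasDerivAt_integral_of_dominated_loc_of_deriv_le (μ := volume.restrict (cell d))
    (F := fun s x => f (s, x)) (F' := fun s x => pt f (s, x)) (bound := fun _ => C)
    (Icc_mem_nhds (by linarith : t - 1 < t) (by linarith : t < t + 1)) ?_
    (hf.continuous.integrableOn_cell t)
    ((continuous_pt hf).integrableOn_cell t).aestronglyMeasurable ?_ ?_ ?_).2
  · exact .of_forall fun s => (hf.continuous.integrableOn_cell s).aestronglyMeasurable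
  · filter_upwards [ae_restrict_mem measurableSet_Icc] with x hx s hs
    exact hC (s, x) ⟨hs, hx⟩
  · exact continuousOn_const.integrableOn_compact (isCompact_cell d)
  · refine .of_forall fun x s _ => ?_
    exact ((hf.differentiable one_ne_zero) (s, x)).hasFDerivAt.comp_hasDerivAt s
      ((hasDerivAt_id s).prodMk (hasDerivAt_const s x))

/-- The divergence of a periodic vector field integrates to zero over the unit cell. -/
theorem integral_cell_divg_eq_zero {d : ℕ} {F : Pt d → Fin d → ℝ}
    (hF : ∀ i, ContDiff ℝ 1 fun q => F q i) (hper : ZPeriodicVec F) (t : ℝ) :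
    ∫ x in cell d, divg F (t, x) = 0 := by
  cases d with
  | zero => simp [divg]
  | succ n =>
    have key := integral_divergence_of_hasFDerivAt_off_countable' (0 : Fin (n + 1) → ℝ) 1
      zero_le_one (fun i x => F (t, x) i)
      (fun i x => (fderiv ℝ (fun q => F q i) (t, x)).comp
        (ContinuousLinearMap.inr ℝ ℝ (Fin (n + 1) → ℝ))) ∅ Set.countable_empty
      (fun i => ((hF i).continuous.comp (Continuous.prodMk_right t)).continuousOn)
      (fun x _ i => (((hF i).differentiable one_ne_zero) (t, x)).hasFDerivAt.comp x
        (hasFDerivAt_prodMk_right t x))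
      ((continuous_finsetSum _ fun i _ => continuous_pd i (hF i)).integrableOn_cell t)
    refine Eq.trans key (Finset.sum_eq_zero fun i _ => sub_eq_zero.2 ?_)
    refine integral_congr_ae (.of_forall fun y => ?_)
    have h := hper i (Pi.single i 1) t (i.insertNth 0 y)
    refine Eq.trans ?_ h
    refine congrArg (fun z => F (t, z) i) (funext fun j => ?_)
    refine Fin.succAboveCases i ?_ (fun k => ?_) j
    · simp
    · simp

theorem fderiv_rpow_mul_apply {E : Type*} [NormedAddCommGroup E] [NormedSpace ℝ E]
    {ρ m : E → ℝ} {p : E} (hρ : DifferentiableAt ℝ ρ p) (hm : DifferentiableAt ℝ m p)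
    (h0 : 0 < ρ p) (s : ℝ) (v : E) :
    fderiv ℝ (fun q => ρ q ^ s * m q) p v
      = ρ p ^ s * fderiv ℝ m p v + m p * (s * ρ p ^ (s - 1) * fderiv ℝ ρ p v) := by
  have h := (hρ.hasFDerivAt.rpow_const (p := s) (.inl h0.ne')).mul hm.hasFDerivAt
  rw [HasFDerivAt.fderiv (f := fun q => ρ q ^ s * m q) h]
  simp

/-- pressure-work identity for one phase (identity (3.3)):
`∫ α ∇(ρ^γ)·u = d/dt ∫ αρ^γ/(γ-1) + ∫ ρ^γ ∂ₜα`. -/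
theorem pressure_work_identity_one_phase
    {d : ℕ} (hd : 1 ≤ d) (γ : ℝ) (hγ : 1 < γ)
    (α ρ : Pt d → ℝ) (u : Pt d → Fin d → ℝ)
    (hreg : ContDiff ℝ (⊤ : ℕ∞) α ∧ ContDiff ℝ (⊤ : ℕ∞) ρ ∧ ContDiff ℝ (⊤ : ℕ∞) u)
    (hper : ZPeriodic α ∧ ZPeriodic ρ ∧ ZPeriodicVec u)
    (hρ : ∀ p, 0 < ρ p)
    (hmass : ∀ p, pt (fun q => α q * ρ q) p
      + divg (fun q j => α q * ρ q * u q j) p = 0) :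
    ∀ t : ℝ,
      (∫ x in cell d,
          α (t, x) * ∑ i, pd i (fun q => ρ q ^ γ) (t, x) * u (t, x) i)
      = deriv (fun s => ∫ x in cell d, α (s, x) * ρ (s, x) ^ γ / (γ - 1)) t
        + ∫ x in cell d, ρ (t, x) ^ γ * pt α (t, x) := by
  obtain ⟨hα, hρd, hu⟩ := hreg
  obtain ⟨pα, pρ, pu⟩ := hper
  intro t
  have hα : ContDiff ℝ 1 α := hα.of_le (by exact_mod_cast le_top)
  have hρd : ContDiff ℝ 1 ρ := hρd.of_le (by exact_mod_cast le_top)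
  have hu : ∀ i, ContDiff ℝ 1 fun q => u q i :=
    contDiff_pi.1 (hu.of_le (by exact_mod_cast le_top))
  have hpow (s : ℝ) : ContDiff ℝ 1 fun q => ρ q ^ s :=
    hρd.rpow_const_of_ne fun q => (hρ q).ne'
  have hE : ContDiff ℝ 1 fun q => α q * ρ q ^ γ / (γ - 1) := (hα.mul (hpow γ)).div_const _
  have hF (i : Fin d) :
      ContDiff ℝ 1 fun q => ρ q ^ (γ - 1) * (γ / (γ - 1) * (α q * ρ q * u q i)) :=
    (hpow _).mul (contDiff_const.mul ((hα.mul hρd).mul (hu i)))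
  have pF : ZPeriodicVec fun q (i : Fin d) =>
      ρ q ^ (γ - 1) * (γ / (γ - 1) * (α q * ρ q * u q i)) := by
    intro i k s x
    have := pu i k s x
    simp only at this
    simp only [pα k s x, pρ k s x, this]
  have iL : IntegrableOn (fun x => α (t, x) * ∑ i, pd i (fun q => ρ q ^ γ) (t, x) * u (t, x) i)
      (cell d) :=
    (hα.continuous.mul (continuous_finsetSum _ fun i _ =>
      (continuous_pd i (hpow γ)).mul (hu i).continuous)).integrableOn_cell t
  have iE : IntegrableOn (fun x => pt (fun q => α q * ρ q ^ γ / (γ - 1)) (t, x)) (cell d) :=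
    (continuous_pt hE).integrableOn_cell t
  have iα : IntegrableOn (fun x => ρ (t, x) ^ γ * pt α (t, x)) (cell d) :=
    ((hpow γ).continuous.mul (continuous_pt hα)).integrableOn_cell t
  rw [(hasDerivAt_integral_cell hE t).deriv, ← integral_add iE iα, ← sub_eq_zero,
    ← integral_sub iL ?_, ← integral_cell_divg_eq_zero hF pF t]
  swap
  · exact iE.add iα
  refine integral_congr_ae (.of_forall fun x => ?_)
  beta_reduce
  generalize (t, x) = p
  have dα := hα.differentiable one_ne_zero p
  have dρ := hρd.differentiable one_ne_zero p
  have du (i : Fin d) := (hu i).differentiable one_ne_zero p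
  have hγ0 : γ - 1 ≠ 0 := by linarith
  have e1 : ρ p ^ γ = ρ p * ρ p ^ (γ - 1) := by
    rw [← rpow_one_add' (hρ p).le (by linarith)]; congr 1; ring
  have e2 : ρ p ^ (γ - 1) = ρ p * ρ p ^ (γ - 1 - 1) := by
    rw [rpow_sub_one (hρ p).ne' (γ - 1)]; field_simp [(hρ p).ne']
  have hmass' : α p * pt ρ p + ρ p * pt α p = -divg (fun q j => α q * ρ q * u q j) p := by
    rw [← eq_neg_of_add_eq_zero_left (hmass p), pt, pt, pt, fderiv_fun_mul dα dρ]
    simp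
  have hpt : pt (fun q => α q * ρ q ^ γ / (γ - 1)) p
      = (ρ p ^ γ * pt α p + α p * (γ * ρ p ^ (γ - 1) * pt ρ p)) / (γ - 1) := by
    have : (fun q => α q * ρ q ^ γ / (γ - 1)) = fun q => ρ q ^ γ * ((γ - 1)⁻¹ * α q) := by
      ext q; ring
    rw [this, pt, fderiv_rpow_mul_apply dρ (dα.const_mul _) (hρ p), fderiv_const_mul dα]
    simp only [pt, smul_eq_mul, smul_apply]
    ring
  have hpow' (i : Fin d) : pd i (fun q => ρ q ^ γ) p = γ * ρ p ^ (γ - 1) * pd i ρ p := by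
    rw [pd, pd, (dρ.hasFDerivAt.rpow_const (p := γ) (.inl (hρ p).ne')).fderiv]
    simp
  have hdiv (i : Fin d) :
      pd i (fun q => ρ q ^ (γ - 1) * (γ / (γ - 1) * (α q * ρ q * u q i))) p
        = γ / (γ - 1) * ρ p ^ (γ - 1) * pd i (fun q => α q * ρ q * u q i) p
          + α p * (γ * ρ p ^ (γ - 1) * pd i ρ p * u p i) := by
    have dm : DifferentiableAt ℝ (fun q => α q * ρ q * u q i) p := (dα.mul dρ).mul (du i)
    rw [pd, fderiv_rpow_mul_apply dρ (dm.const_mul _) (hρ p), fderiv_const_mul dm, e2]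
    simp only [pd, smul_eq_mul, smul_apply]
    field_simp
  rw [hpt, divg]
  simp only [hpow', hdiv]
  rw [Finset.sum_add_distrib, ← Finset.mul_sum, ← Finset.mul_sum]
  have hm := hmass'
  rw [divg] at hm
  rw [← neg_eq_iff_eq_neg.2 hm, e1]
  field_simp
  ring
end
end

section
/- Derivation of the divergence constraint in the non-isentropic one-velocity case (equation (divuI) of the paper), together with the transport of the leading densities. Let d ≥ 1 and γ₊, γ₋ > 1. Let C : ℝ → (0,∞) be C¹, let α₊, α₋, S₊, S₋ : ℝ × ℝ^d → ℝ be C¹ with α₊ + α₋ = 1, and let u : ℝ × ℝ^d → ℝ^d be C¹. Define ρ±(t,x) := C(t)^{1/γ±} e^{−S±(t,x)/γ±}. If ∂ₜS± + u·∇S± = 0 and ∂ₜ(α±ρ±) + div(α±ρ±u) = 0 for both phases, then pointwise: ∂ₜρ± + u·∇ρ± = (ρ±/γ±)·C′(t)/C(t) for both phases, and div u + (α₊/γ₊ + α₋/γ₋)·C′(t)/C(t) = 0. -/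
open MeasureTheory Real

noncomputable section

/-- Derivative along the flow, `∂ₜ f + v · ∇f`, as a single directional derivative. -/
theorem pt_add_sum_pd_eq_fderiv {d : ℕ} (f : Pt d → ℝ) (p : Pt d) (v : Fin d → ℝ) :
    pt f p + ∑ i, v i * pd i f p = fderiv ℝ f p (1, v) := by
  have hv : ((1, v) : Pt d) = (1, 0) + ∑ i, v i • ((0, Pi.single i 1) : Pt d) := by
    ext j
    · simp [Prod.fst_sum]
    · simp [Prod.snd_sum, Finset.sum_apply, Pi.single_apply]
  simp only [hv, map_add, map_sum, map_smul, smul_eq_mul, pt, pd]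

/-- Leibniz rule `div (f u) = u · ∇f + f div u`. -/
theorem divg_mul {d : ℕ} {f : Pt d → ℝ} {u : Pt d → Fin d → ℝ} {p : Pt d}
    (hf : DifferentiableAt ℝ f p) (hu : DifferentiableAt ℝ u p) :
    divg (fun q j => f q * u q j) p = ∑ i, u p i * pd i f p + f p * divg u p := by
  simp only [divg, Finset.mul_sum, ← Finset.sum_add_distrib]
  refine Finset.sum_congr rfl fun i _ => ?_
  have hui : DifferentiableAt ℝ (fun q => u q i) p := differentiableAt_pi.1 hu i
  simp only [pd, fderiv_fun_mul hf hui, add_apply, smul_apply, smul_eq_mul]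
  ring

/-- Conservation of mass in terms of the derivative along the flow. -/
theorem pt_add_divg_mul {d : ℕ} {f : Pt d → ℝ} {u : Pt d → Fin d → ℝ} {p : Pt d}
    (hf : DifferentiableAt ℝ f p) (hu : DifferentiableAt ℝ u p) :
    pt f p + divg (fun q j => f q * u q j) p = fderiv ℝ f p (1, u p) + f p * divg u p := by
  rw [divg_mul hf hu, ← pt_add_sum_pd_eq_fderiv]
  ring

/-- Derivative of `C(t)^{1/γ} e^{-S/γ}` in a direction of unit time component along which `S` is
stationary. -/
theorem exists_hasFDerivAt_density {d : ℕ} {γ : ℝ} {C : ℝ → ℝ} {S : Pt d → ℝ} {p : Pt d}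
    (hCpos : 0 < C p.1) (hC : DifferentiableAt ℝ C p.1) (hS : DifferentiableAt ℝ S p) :
    ∃ L : Pt d →L[ℝ] ℝ,
      HasFDerivAt (fun q : Pt d => C q.1 ^ (1 / γ) * Real.exp (-S q / γ)) L p ∧
      ∀ v : Fin d → ℝ, fderiv ℝ S p (1, v) = 0 →
        L (1, v) = C p.1 ^ (1 / γ) * Real.exp (-S p / γ) / γ * (deriv C p.1 / C p.1) := by
  have hC' : HasFDerivAt (fun q : Pt d => C q.1)
      (deriv C p.1 • ContinuousLinearMap.fst ℝ ℝ (Fin d → ℝ)) p :=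
    hC.hasDerivAt.comp_hasFDerivAt p hasFDerivAt_fst
  have hpow := hC'.rpow_const (p := 1 / γ) (Or.inl hCpos.ne')
  have hexp := (hS.hasFDerivAt.neg.mul_const γ⁻¹).exp
  simp only [Pi.neg_apply, ← div_eq_mul_inv] at hexp
  refine ⟨_, hpow.mul hexp, fun v hv => ?_⟩
  simp only [add_apply, smul_apply, neg_apply,
    hv, Real.rpow_sub_one hCpos.ne', ContinuousLinearMap.coe_fst', smul_eq_mul]
  ring

/-- Transport of `ρ = C(t)^{1/γ} e^{-S/γ}` when `S` is transported by `u`, and the equation for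
`α` which follows from conservation of the mass `α ρ`. -/
theorem density_transport_and_fraction_equation {d : ℕ} {γ : ℝ} {C : ℝ → ℝ} {α S : Pt d → ℝ}
    {u : Pt d → Fin d → ℝ} {p : Pt d}
    (hCpos : 0 < C p.1) (hC : DifferentiableAt ℝ C p.1) (hα : DifferentiableAt ℝ α p)
    (hS : DifferentiableAt ℝ S p) (hu : DifferentiableAt ℝ u p)
    (hent : pt S p + ∑ i, u p i * pd i S p = 0)
    (hmass : pt (fun q => α q * (C q.1 ^ (1 / γ) * Real.exp (-S q / γ))) p
      + divg (fun q j => α q * (C q.1 ^ (1 / γ) * Real.exp (-S q / γ)) * u q j) p = 0) :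
    (pt (fun q => C q.1 ^ (1 / γ) * Real.exp (-S q / γ)) p
        + ∑ i, u p i * pd i (fun q => C q.1 ^ (1 / γ) * Real.exp (-S q / γ)) p
      = ((C p.1 ^ (1 / γ) * Real.exp (-S p / γ)) / γ) * (deriv C p.1 / C p.1)) ∧
    fderiv ℝ α p (1, u p) + α p / γ * (deriv C p.1 / C p.1) + α p * divg u p = 0 := by
  rw [pt_add_sum_pd_eq_fderiv] at hent ⊢
  obtain ⟨L, hL, hLv⟩ := exists_hasFDerivAt_density (γ := γ) hCpos hC hS
  have hρ := hLv _ hent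
  refine ⟨hL.fderiv ▸ hρ, ?_⟩
  rw [pt_add_divg_mul (hα.fun_mul hL.differentiableAt) hu,
    fderiv_fun_mul hα hL.differentiableAt, hL.fderiv] at hmass
  simp only [add_apply, smul_apply, smul_eq_mul, hρ] at hmass
  have hpos : 0 < C p.1 ^ (1 / γ) * Real.exp (-S p / γ) := by positivity
  refine (mul_eq_zero.1 ?_).resolve_left hpos.ne'
  rw [← hmass]
  ring

/-- divergence constraint in the non-isentropic one-velocity case
(equation (divuI)), together with transport of the leading densities.
With `ρ± = C(t)^{1/γ±} e^{-S±/γ±}`, entropy transport and the mass equations imply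
`∂ₜρ± + u·∇ρ± = (ρ±/γ±) C'/C` and `div u + (α₊/γ₊ + α₋/γ₋) C'/C = 0`. -/
theorem divergence_constraint_nonisentropic_one_velocity
    {d : ℕ} (hd : 1 ≤ d) (γp γm : ℝ) (hγp : 1 < γp) (hγm : 1 < γm)
    (C : ℝ → ℝ) (hCpos : ∀ t, 0 < C t) (hC : ContDiff ℝ 1 C)
    (αp αm Sp Sm : Pt d → ℝ)
    (hαp : ContDiff ℝ 1 αp) (hαm : ContDiff ℝ 1 αm)
    (hSp : ContDiff ℝ 1 Sp) (hSm : ContDiff ℝ 1 Sm)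
    (hα : ∀ p, αp p + αm p = 1)
    (u : Pt d → Fin d → ℝ) (hu : ContDiff ℝ 1 u)
    (hentp : ∀ p : Pt d, pt Sp p + ∑ i, u p i * pd i Sp p = 0)
    (hentm : ∀ p : Pt d, pt Sm p + ∑ i, u p i * pd i Sm p = 0)
    (hmassp : ∀ p : Pt d,
      pt (fun q => αp q * (C q.1 ^ (1 / γp) * Real.exp (-Sp q / γp))) p
      + divg (fun q j => αp q * (C q.1 ^ (1 / γp) * Real.exp (-Sp q / γp)) * u q j) p = 0)
    (hmassm : ∀ p : Pt d,
      pt (fun q => αm q * (C q.1 ^ (1 / γm) * Real.exp (-Sm q / γm))) p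
      + divg (fun q j => αm q * (C q.1 ^ (1 / γm) * Real.exp (-Sm q / γm)) * u q j) p = 0) :
    (∀ p : Pt d,
      pt (fun q => C q.1 ^ (1 / γp) * Real.exp (-Sp q / γp)) p
        + ∑ i, u p i * pd i (fun q => C q.1 ^ (1 / γp) * Real.exp (-Sp q / γp)) p
      = ((C p.1 ^ (1 / γp) * Real.exp (-Sp p / γp)) / γp) * (deriv C p.1 / C p.1)) ∧
    (∀ p : Pt d,
      pt (fun q => C q.1 ^ (1 / γm) * Real.exp (-Sm q / γm)) p
        + ∑ i, u p i * pd i (fun q => C q.1 ^ (1 / γm) * Real.exp (-Sm q / γm)) p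
      = ((C p.1 ^ (1 / γm) * Real.exp (-Sm p / γm)) / γm) * (deriv C p.1 / C p.1)) ∧
    (∀ p : Pt d,
      divg u p + (αp p / γp + αm p / γm) * (deriv C p.1 / C p.1) = 0) := by
  have key (p : Pt d) (γ : ℝ) {α S : Pt d → ℝ} (hα : ContDiff ℝ 1 α) (hS : ContDiff ℝ 1 S) :=
    density_transport_and_fraction_equation (γ := γ) (hCpos p.1)
      (hC.differentiable one_ne_zero p.1) (hα.differentiable one_ne_zero p)
      (hS.differentiable one_ne_zero p) (hu.differentiable one_ne_zero p)
  refine ⟨fun p => (key p γp hαp hSp (hentp p) (hmassp p)).1,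
    fun p => (key p γm hαm hSm (hentm p) (hmassm p)).1, fun p => ?_⟩
  have hp := (key p γp hαp hSp (hentp p) (hmassp p)).2
  have hm := (key p γm hαm hSm (hentm p) (hmassm p)).2
  have hsum : fderiv ℝ αp p (1, u p) + fderiv ℝ αm p (1, u p) = 0 := by
    rw [← add_apply, ← fderiv_fun_add (hαp.differentiable one_ne_zero p)
      (hαm.differentiable one_ne_zero p), funext hα]
    simp
  linear_combination hp + hm - hsum - divg u p * hα p
end
end
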